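/- arXiv:2511.02982 — 2 statements merged into one kernel-verified Lean document; each statement's English description precedes it below -/
import Mathlib

section
/- Let p be a prime and n a natural number, and let a_{n,p} denote the number of subspaces of the 𝔽_p-vector space 𝔽_p^n. Then, as real numbers, p^{(n² − 1)/4} ≤ a_{n,p} ≤ p^{(n + 1.1)²/4}. -/
/-- `a_{m,p}`: the number of `𝔽_p`-linear subspaces of the vector space `𝔽_p^m`. -/
noncomputable def numSubspaces (p m : ℕ) : ℕ :=
  Nat.card (Submodule (ZMod p) (Fin m → ZMod p))

section Counting

variable {K V W : Type*} [Field K] [AddCommGroup V] [Module K V] [AddCommGroup W] [Module K W]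

/-- Submodules of `V × W` that meet `0 × W` trivially are the graphs of partial linear maps. -/
noncomputable def linearPMapEquivGraph : (V →ₗ.[K] W) ≃
    {g : Submodule K (V × W) // ∀ x ∈ g, x.fst = 0 → x.snd = 0} where
  toFun f := ⟨f.graph, fun _ hx h => f.graph_fst_eq_zero_snd hx h⟩
  invFun g := g.1.toLinearPMap
  left_inv f := LinearPMap.eq_of_eq_graph
    (Submodule.toLinearPMap_graph_eq _ fun _ hx h => f.graph_fst_eq_zero_snd hx h)
  right_inv g := Subtype.ext (Submodule.toLinearPMap_graph_eq _ g.2)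

/-- A partial linear map is a domain together with a linear map on it. -/
def linearPMapEquivSigma : (V →ₗ.[K] W) ≃ Σ U : Submodule K V, U →ₗ[K] W where
  toFun f := ⟨f.domain, f.toFun⟩
  invFun f := ⟨f.1, f.2⟩
  left_inv _ := rfl
  right_inv _ := rfl

theorem Submodule.forall_snd_eq_zero_iff (g : Submodule K (V × K)) :
    (∀ x ∈ g, x.fst = 0 → x.snd = 0) ↔ ((0, 1) : V × K) ∉ g := by
  constructor
  · intro h h1
    exact one_ne_zero (h _ h1 rfl)
  · rintro h ⟨v, c⟩ hx rfl
    by_contra hc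
    refine h ?_
    have := g.smul_mem c⁻¹ hx
    simpa [inv_mul_cancel₀ hc] using this

theorem Submodule.natCard_dual [Module.Finite K V] (U : Submodule K V) :
    Nat.card (U →ₗ[K] K) = Nat.card U := by
  have h : Module.finrank K (U →ₗ[K] K) = Module.finrank K U :=
    Subspace.dual_finrank_eq (K := K) (V := U)
  rw [Module.natCard_eq_pow_finrank (K := K), Module.natCard_eq_pow_finrank (K := K) (V := U), h]

theorem Submodule.natCard_mem_eq_natCard_quotient (v : V) :
    Nat.card {U : Submodule K V // v ∈ U} = Nat.card (Submodule K (V ⧸ K ∙ v)) := by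
  refine Nat.card_congr (Equiv.trans (Equiv.subtypeEquivRight fun U => ?_)
    (Submodule.comapMkQRelIso (K ∙ v)).toEquiv.symm)
  simp [Set.mem_Ici, Submodule.span_singleton_le_iff_mem]

end Counting

section Recursion

variable {p : ℕ} [Fact p.Prime] {V : Type*} [AddCommGroup V] [Module (ZMod p) V]
  [Module.Finite (ZMod p) V]

theorem natCard_submodule_eq_numSubspaces {n : ℕ} (h : Module.finrank (ZMod p) V = n) :
    Nat.card (Submodule (ZMod p) V) = numSubspaces p n :=
  Nat.card_congr (Submodule.orderIsoMapComap
    (LinearEquiv.ofFinrankEq V (Fin n → ZMod p) (by simp [h]))).toEquiv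

theorem natCard_submodule_mem {n : ℕ} (h : Module.finrank (ZMod p) V = n + 1) {v : V}
    (hv : v ≠ 0) : Nat.card {U : Submodule (ZMod p) V // v ∈ U} = numSubspaces p n := by
  rw [Submodule.natCard_mem_eq_natCard_quotient]
  apply natCard_submodule_eq_numSubspaces
  have := Submodule.finrank_quotient_add_finrank (ZMod p ∙ v)
  rw [finrank_span_singleton hv] at this
  omega

theorem sum_natCard_submodule (n : ℕ) (h : Module.finrank (ZMod p) V = n + 1)
    [Fintype (Submodule (ZMod p) V)] :
    ∑ U : Submodule (ZMod p) V, Nat.card U =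
      numSubspaces p (n + 1) + (p ^ (n + 1) - 1) * numSubspaces p n := by
  classical
  have : Finite V := Module.finite_of_finite (ZMod p)
  have : Fintype V := Fintype.ofFinite V
  have hV : Fintype.card V = p ^ (n + 1) := by
    rw [Module.card_eq_pow_finrank (K := ZMod p), ZMod.card, h]
  have e : (Σ U : Submodule (ZMod p) V, U) ≃
      Σ v : V, {U : Submodule (ZMod p) V // v ∈ U} :=
    ⟨fun x => ⟨x.2.1, x.1, x.2.2⟩, fun x => ⟨x.2.1, x.1, x.2.2⟩, fun _ => rfl, fun _ => rfl⟩
  rw [← Nat.card_sigma, Nat.card_congr e, Nat.card_sigma,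
    ← Finset.add_sum_erase _ _ (Finset.mem_univ (0 : V)),
    Finset.sum_congr rfl fun v hv => natCard_submodule_mem h (Finset.ne_of_mem_erase hv)]
  simp [hV, Finset.card_erase_of_mem, ← natCard_submodule_eq_numSubspaces h]

theorem numSubspaces_succ_eq_add_sum (n : ℕ) (h : Module.finrank (ZMod p) V = n)
    [Fintype (Submodule (ZMod p) V)] :
    numSubspaces p (n + 1) =
      numSubspaces p n + ∑ U : Submodule (ZMod p) V, Nat.card U := by
  classical
  have hVK : Module.finrank (ZMod p) (V × ZMod p) = n + 1 := by simp [h]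
  have : Finite V := Module.finite_of_finite (ZMod p)
  have (U : Submodule (ZMod p) V) : Finite (U →ₗ[ZMod p] ZMod p) :=
    Module.finite_of_finite (ZMod p)
  rw [← natCard_submodule_eq_numSubspaces hVK,
    Nat.card_congr (Equiv.sumCompl fun g : Submodule (ZMod p) (V × ZMod p) =>
      ((0, 1) : V × ZMod p) ∈ g).symm, Nat.card_sum,
    natCard_submodule_mem hVK (by simp),
    ← Nat.card_congr (Equiv.subtypeEquivRight Submodule.forall_snd_eq_zero_iff),
    ← Nat.card_congr linearPMapEquivGraph, Nat.card_congr linearPMapEquivSigma, Nat.card_sigma]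
  simp only [Submodule.natCard_dual]

end Recursion

theorem numSubspaces_zero (p : ℕ) : numSubspaces p 0 = 1 := by
  simp [numSubspaces]

theorem numSubspaces_one (p : ℕ) [Fact p.Prime] : numSubspaces p 1 = 2 := by
  have : Fintype (Submodule (ZMod p) (Fin 0 → ZMod p)) := Fintype.ofFinite _
  rw [numSubspaces_succ_eq_add_sum (V := Fin 0 → ZMod p) 0 (by simp), numSubspaces_zero]
  simp

/-- The recursion satisfied by the Galois numbers. -/
theorem numSubspaces_add_two (p n : ℕ) [Fact p.Prime] :
    numSubspaces p (n + 2) =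
      2 * numSubspaces p (n + 1) + (p ^ (n + 1) - 1) * numSubspaces p n := by
  have : Fintype (Submodule (ZMod p) (Fin (n + 1) → ZMod p)) := Fintype.ofFinite _
  rw [numSubspaces_succ_eq_add_sum (V := Fin (n + 1) → ZMod p) (n + 1) (by simp),
    sum_natCard_submodule n (by simp)]
  ring

theorem numSubspaces_add_two_cast (p n : ℕ) [hp : Fact p.Prime] :
    (numSubspaces p (n + 2) : ℝ) =
      2 * numSubspaces p (n + 1) + ((p : ℝ) ^ (n + 1) - 1) * numSubspaces p n := by
  rw [numSubspaces_add_two, Nat.cast_add, Nat.cast_mul, Nat.cast_mul,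
    Nat.cast_sub (Nat.one_le_pow _ _ hp.out.pos)]
  simp

theorem numSubspaces_le_succ (p n : ℕ) [hp : Fact p.Prime] :
    numSubspaces p n ≤ numSubspaces p (n + 1) := by
  have : Fintype (Submodule (ZMod p) (Fin n → ZMod p)) := Fintype.ofFinite _
  rw [numSubspaces_succ_eq_add_sum (V := Fin n → ZMod p) n (by simp)]
  exact Nat.le_add_right _ _

theorem rpow_le_numSubspaces (p : ℕ) [hp : Fact p.Prime] (n : ℕ) :
    (p : ℝ) ^ (((n : ℝ) ^ 2 - 1) / 4) ≤ numSubspaces p n := by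
  have hp1 : (1 : ℝ) ≤ p := by exact_mod_cast hp.out.one_le
  induction n using Nat.twoStepInduction with
  | zero =>
    rw [numSubspaces_zero, Nat.cast_one]
    exact Real.rpow_le_one_of_one_le_of_nonpos hp1 (by norm_num)
  | one => norm_num [numSubspaces_one]
  | more n ih _ =>
    have hmono : (numSubspaces p n : ℝ) ≤ numSubspaces p (n + 1) := by
      exact_mod_cast numSubspaces_le_succ p n
    have hexp : (((n + 2 : ℕ) : ℝ) ^ 2 - 1) / 4 =
        ((n + 1 : ℕ) : ℝ) + ((n : ℝ) ^ 2 - 1) / 4 := by push_cast; ring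
    rw [numSubspaces_add_two_cast, hexp, Real.rpow_add (by linarith), Real.rpow_natCast]
    have := mul_le_mul_of_nonneg_left ih (by positivity : (0 : ℝ) ≤ (p : ℝ) ^ (n + 1))
    have : (0 : ℝ) ≤ numSubspaces p n := Nat.cast_nonneg _
    linarith

theorem le_rpow_of_pow_ten_le {a x : ℝ} (m : ℕ) (hx : 0 ≤ x) (h : a ^ 10 ≤ x ^ m) :
    a ≤ x ^ ((m : ℝ) / 10) := by
  refine le_of_pow_le_pow_left₀ (n := 10) (by norm_num) (by positivity) ?_
  rwa [← Real.rpow_natCast (x ^ ((m : ℝ) / 10)), ← Real.rpow_mul hx, Nat.cast_ofNat,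
    div_mul_cancel₀ _ (by norm_num), Real.rpow_natCast]

theorem numSubspaces_le_rpow (p : ℕ) [hp : Fact p.Prime] (n : ℕ) :
    (numSubspaces p n : ℝ) ≤ (p : ℝ) ^ (((n : ℝ) + 1.1) ^ 2 / 4) := by
  have hp2 : (2 : ℝ) ≤ p := by exact_mod_cast hp.out.two_le
  have hp0 : (0 : ℝ) < p := by linarith
  have h1 : numSubspaces p 1 = 2 := numSubspaces_one p
  have h2 : (numSubspaces p 2 : ℝ) = p + 3 := by
    rw [numSubspaces_add_two_cast, h1, numSubspaces_zero]; push_cast; ring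
  have key (m : ℕ) {a : ℝ} (h : a ^ 10 ≤ 2 ^ m) {e : ℝ} (he : (m : ℝ) / 10 ≤ e) :
      a ≤ (p : ℝ) ^ e :=
    calc a ≤ (2 : ℝ) ^ ((m : ℝ) / 10) := le_rpow_of_pow_ten_le m (by norm_num) h
      _ ≤ (p : ℝ) ^ ((m : ℝ) / 10) := by gcongr
      _ ≤ (p : ℝ) ^ e := Real.rpow_le_rpow_of_exponent_le (by linarith) he
  induction n using Nat.twoStepInduction with
  | zero =>
    rw [numSubspaces_zero]
    exact key 0 (by norm_num) (by norm_num)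
  | one =>
    rw [h1]
    exact key 11 (by norm_num) (by norm_num)
  | more n ih ih' =>
    match n with
    | 0 =>
      rw [h2]
      rcases hp.out.two_le.eq_or_lt with rfl | hp3
      · exact key 24 (by norm_num) (by norm_num)
      · have hp3 : (3 : ℝ) ≤ p := by exact_mod_cast hp3
        calc (p : ℝ) + 3 ≤ (p : ℝ) ^ 2 := by nlinarith
          _ = (p : ℝ) ^ (2 : ℝ) := (Real.rpow_two _).symm
          _ ≤ _ := Real.rpow_le_rpow_of_exponent_le (by linarith) (by norm_num)
    | 1 =>
      rw [numSubspaces_add_two_cast, h1, h2]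
      calc 2 * ((p : ℝ) + 3) + ((p : ℝ) ^ (1 + 1) - 1) * (2 : ℕ) ≤ (p : ℝ) ^ 4 := by
            push_cast
            nlinarith [mul_nonneg (by linarith : (0 : ℝ) ≤ p - 2) (pow_nonneg hp0.le 3),
              mul_nonneg (by linarith : (0 : ℝ) ≤ p - 2) (pow_nonneg hp0.le 2)]
        _ = (p : ℝ) ^ ((4 : ℕ) : ℝ) := (Real.rpow_natCast _ _).symm
        _ ≤ _ := Real.rpow_le_rpow_of_exponent_le (by linarith) (by norm_num)
    | k + 2 =>
      set n := k + 2 with hn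
      have hn2 : (2 : ℝ) ≤ n := by rw [hn]; push_cast; linarith [k.cast_nonneg (α := ℝ)]
      set b : ℝ → ℝ := fun x => (p : ℝ) ^ ((x + 1.1) ^ 2 / 4) with hb
      have hb0 (x : ℝ) : 0 ≤ b x := by positivity
      have hstep : 4.9 * b (n + 1 : ℕ) ≤ b (n + 2 : ℕ) := by
        have he : (((n + 2 : ℕ) : ℝ) + 1.1) ^ 2 / 4 =
            ((n : ℝ) / 2 + 1.3) + (((n + 1 : ℕ) : ℝ) + 1.1) ^ 2 / 4 := by push_cast; ring
        simp only [hb]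
        rw [he, Real.rpow_add hp0]
        gcongr
        exact key 23 (by norm_num) (by norm_num; linarith)
      have hstep' : 2.1 * ((p : ℝ) ^ (n + 1) * b n) ≤ b (n + 2 : ℕ) := by
        have he : (((n + 2 : ℕ) : ℝ) + 1.1) ^ 2 / 4 =
            1.1 + (((n + 1 : ℕ) : ℝ) + ((n : ℝ) + 1.1) ^ 2 / 4) := by push_cast; ring
        simp only [hb]
        rw [he, Real.rpow_add hp0, Real.rpow_add hp0, Real.rpow_natCast]
        gcongr
        exact key 11 (by norm_num) (by norm_num)
      have hmul := mul_le_mul_of_nonneg_left ih (by positivity : (0 : ℝ) ≤ (p : ℝ) ^ (n + 1))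
      have hnonneg : (0 : ℝ) ≤ numSubspaces p n := Nat.cast_nonneg _
      have := hb0 (n + 2 : ℕ)
      change (numSubspaces p (n + 1) : ℝ) ≤ b (n + 1 : ℕ) at ih'
      change _ ≤ (p : ℝ) ^ (n + 1) * b n at hmul
      change _ ≤ b (n + 2 : ℕ)
      rw [numSubspaces_add_two_cast]
      linarith

/-- Bounds: `p^{(n² − 1)/4} ≤ a_{n,p} ≤ p^{(n + 1.1)²/4}` as real numbers. -/
theorem numSubspaces_bounds (p n : ℕ) (hp : p.Prime) :
    (p : ℝ) ^ (((n : ℝ) ^ 2 - 1) / 4) ≤ (numSubspaces p n : ℝ) ∧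
      (numSubspaces p n : ℝ) ≤ (p : ℝ) ^ (((n : ℝ) + 1.1) ^ 2 / 4) :=
  have : Fact p.Prime := ⟨hp⟩
  ⟨rpow_le_numSubspaces p n, numSubspaces_le_rpow p n⟩
end

section
/- Fix a natural number n > 2. Then δ(n, p) tends to 1 as p tends to infinity over primes; that is, for every ε > 0 there exists N such that for every prime p ≥ N, |δ(n, p) − 1| < ε, where δ(n, p) = 1 − (Σ_{d=1}^{n} [n choose d]_p · [d choose 1]_p · (a_{d,p} − a_{d−1,p})) / ([n choose 1]_p · (a_{n,p} − 1) · a_{n−1,p}). -/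
/-- The Gaussian (`p`-)binomial coefficient `[n choose d]_p`: the number of `d`-dimensional
subspaces of the `𝔽_p`-vector space `𝔽_p^n`. -/
noncomputable def gaussBinom (p n d : ℕ) : ℕ :=
  Nat.card {W : Submodule (ZMod p) (Fin n → ZMod p) // Module.finrank (ZMod p) W = d}

/-- The density `δ(n, p)` of the reduced formal context of `Sat(Sub(C_p^n))`. -/
noncomputable def density (n p : ℕ) : ℝ :=
  1 - (∑ d ∈ Finset.Icc 1 n, (gaussBinom p n d : ℝ) * (gaussBinom p d 1 : ℝ) *
        ((numSubspaces p d : ℝ) - (numSubspaces p (d - 1) : ℝ))) /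
      ((gaussBinom p n 1 : ℝ) * ((numSubspaces p n : ℝ) - 1) * (numSubspaces p (n - 1) : ℝ))

/-- Each `d`-dimensional subspace of `𝔽_p^n` has as many ordered bases as `𝔽_p^d`. -/
theorem gaussBinom_mul_card_linearIndependent_le (p n d : ℕ) [Fact p.Prime] :
    gaussBinom p n d *
        Nat.card {s : Fin d → Fin d → ZMod p // LinearIndependent (ZMod p) s} ≤
      (p ^ n) ^ d := by
  have he : ∀ W : {W : Submodule (ZMod p) (Fin n → ZMod p) // Module.finrank (ZMod p) W = d},
      Nonempty ((Fin d → ZMod p) ≃ₗ[ZMod p] W.1) := fun W =>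
    FiniteDimensional.nonempty_linearEquiv_of_finrank_eq (by simp [W.2])
  let e := fun W => (he W).some
  let f : {W : Submodule (ZMod p) (Fin n → ZMod p) // Module.finrank (ZMod p) W = d} ×
      {s : Fin d → Fin d → ZMod p // LinearIndependent (ZMod p) s} →
      (Fin d → Fin n → ZMod p) := fun x i => (e x.1 (x.2.1 i) : Fin n → ZMod p)
  have hspan : ∀ x, Submodule.span (ZMod p) (Set.range (f x)) = x.1.1 := by
    rintro ⟨W, s, hs⟩
    have h1 : Submodule.span (ZMod p) (Set.range s) = ⊤ :=
      hs.span_eq_top_of_card_eq_finrank' (by simp)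
    have h2 : Set.range (f (W, ⟨s, hs⟩)) =
        (W.1.subtype ∘ₗ (e W).toLinearMap) '' Set.range s := by
      rw [← Set.range_comp]; rfl
    rw [h2, ← Submodule.map_span, h1, Submodule.map_comp, Submodule.map_top,
      LinearEquiv.range, Submodule.map_top, Submodule.range_subtype]
  have hf : Function.Injective f := by
    rintro ⟨W, s⟩ ⟨W', s'⟩ h
    have hW : W = W' := Subtype.ext (by
      rw [← hspan (W, s), h, hspan])
    subst hW
    congr 1
    ext1
    funext i
    have := congrFun h i
    exact (e W).injective (Subtype.ext this)
  have := Nat.card_le_card_of_injective f hf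
  rw [Nat.card_prod] at this
  simpa [gaussBinom, Nat.card_fun] using this

theorem pow_mul_self_le_two_pow_mul_card_linearIndependent (p d : ℕ) [Fact p.Prime] :
    p ^ (d * d) ≤
      2 ^ d * Nat.card {s : Fin d → Fin d → ZMod p // LinearIndependent (ZMod p) s} := by
  have hp := (Fact.out : p.Prime).two_le
  rw [card_linearIndependent (by simp)]
  simp only [Module.finrank_fin_fun, ZMod.card]
  calc p ^ (d * d) = ∏ _i : Fin d, p ^ d := by simp [pow_mul]
    _ ≤ ∏ i : Fin d, 2 * (p ^ d - p ^ (i : ℕ)) := by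
        refine Finset.prod_le_prod' fun i _ => ?_
        have h : p ^ (i : ℕ) * 2 ≤ p ^ d := calc
          p ^ (i : ℕ) * 2 ≤ p ^ (i : ℕ) * p := by gcongr
          _ = p ^ ((i : ℕ) + 1) := (pow_succ _ _).symm
          _ ≤ p ^ d := Nat.pow_le_pow_right (by omega) i.2
        omega
    _ = _ := by simp [Finset.prod_mul_distrib]

theorem gaussBinom_le (p n d : ℕ) [Fact p.Prime] (hd : d ≤ n) :
    gaussBinom p n d ≤ 2 ^ d * p ^ (d * (n - d)) := by
  have hp := (Fact.out : p.Prime).pos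
  have h1 := gaussBinom_mul_card_linearIndependent_le p n d
  have h2 := pow_mul_self_le_two_pow_mul_card_linearIndependent p d
  refine Nat.le_of_mul_le_mul_right ?_ (pow_pos hp (d * d))
  calc gaussBinom p n d * p ^ (d * d) ≤ gaussBinom p n d * (2 ^ d * _) := by gcongr
    _ = 2 ^ d * (gaussBinom p n d * _) := mul_left_comm _ _ _
    _ ≤ 2 ^ d * (p ^ n) ^ d := by gcongr
    _ = 2 ^ d * p ^ (d * (n - d)) * p ^ (d * d) := by
      obtain ⟨k, rfl⟩ := Nat.exists_eq_add_of_le hd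
      rw [Nat.add_sub_cancel_left]; ring

theorem numSubspaces_eq_sum_gaussBinom (p m : ℕ) [Fact p.Prime] :
    numSubspaces p m = ∑ d ∈ Finset.range (m + 1), gaussBinom p m d := by
  classical
  have : Fintype (Submodule (ZMod p) (Fin m → ZMod p)) := Fintype.ofFinite _
  rw [numSubspaces, Nat.card_eq_fintype_card, ← Finset.card_univ,
    Finset.card_eq_sum_card_fiberwise (t := Finset.range (m + 1))
      (f := fun W : Submodule (ZMod p) (Fin m → ZMod p) => Module.finrank (ZMod p) W)]
  · refine Finset.sum_congr rfl fun d _ => ?_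
    rw [gaussBinom, Nat.card_eq_fintype_card, Fintype.card_subtype]
  · intro W _
    have := W.finrank_le
    simp at this ⊢
    omega

theorem numSubspaces_le (p m : ℕ) [Fact p.Prime] :
    numSubspaces p m ≤ (m + 1) * 2 ^ m * p ^ (m * m / 4) := by
  have hp := (Fact.out : p.Prime).pos
  rw [numSubspaces_eq_sum_gaussBinom]
  calc ∑ d ∈ Finset.range (m + 1), gaussBinom p m d
      ≤ ∑ _d ∈ Finset.range (m + 1), 2 ^ m * p ^ (m * m / 4) := by
        refine Finset.sum_le_sum fun d hd => ?_
        have hd : d ≤ m := by simpa [Nat.lt_succ_iff] using hd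
        refine (gaussBinom_le p m d hd).trans ?_
        refine Nat.mul_le_mul (Nat.pow_le_pow_right two_pos hd) (Nat.pow_le_pow_right hp ?_)
        obtain ⟨k, rfl⟩ := Nat.exists_eq_add_of_le hd
        rw [Nat.add_sub_cancel_left, Nat.le_div_iff_mul_le (by norm_num)]
        zify
        nlinarith [sq_nonneg ((d : ℤ) - k)]
    _ = _ := by simp [mul_assoc]

/-- The graphs of the linear maps `𝔽_p^d → 𝔽_p^k` are `d`-dimensional subspaces. -/
theorem pow_le_gaussBinom (p d k : ℕ) [Fact p.Prime] :
    p ^ (d * k) ≤ gaussBinom p (d + k) d := by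
  obtain ⟨e⟩ : Nonempty (((Fin d → ZMod p) × (Fin k → ZMod p)) ≃ₗ[ZMod p]
      (Fin (d + k) → ZMod p)) :=
    FiniteDimensional.nonempty_linearEquiv_of_finrank_eq (by simp)
  let f : ((Fin d → ZMod p) →ₗ[ZMod p] (Fin k → ZMod p)) →
      {W : Submodule (ZMod p) (Fin (d + k) → ZMod p) // Module.finrank (ZMod p) W = d} :=
    fun g => ⟨g.graph.map e.toLinearMap, by
      rw [LinearEquiv.finrank_map_eq, LinearMap.graph_eq_range_prod,
        LinearMap.finrank_range_of_inj]
      · simp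
      · intro x y h
        exact congrArg Prod.fst h⟩
  have hf : Function.Injective f := by
    intro g g' h
    have h' := Submodule.map_injective_of_injective e.injective (congrArg Subtype.val h)
    refine LinearMap.ext fun x => ?_
    have hx : (x, g x) ∈ g'.graph := by
      rw [← h', LinearMap.mem_graph_iff]
    exact (LinearMap.mem_graph_iff (f := g') (x := (x, g x))).1 hx
  have := Nat.card_le_card_of_injective f hf
  rwa [Module.natCard_eq_pow_finrank (K := ZMod p), Module.finrank_linearMap,
    Module.finrank_fin_fun, Module.finrank_fin_fun, Nat.card_zmod] at this

theorem pow_le_numSubspaces (p m : ℕ) [Fact p.Prime] :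
    p ^ (m / 2 * (m - m / 2)) ≤ numSubspaces p m := by
  have h := pow_le_gaussBinom p (m / 2) (m - m / 2)
  rw [Nat.add_sub_cancel' (Nat.div_le_self m 2)] at h
  refine h.trans ?_
  rw [numSubspaces_eq_sum_gaussBinom]
  exact Finset.single_le_sum (f := fun d => gaussBinom p m d) (fun _ _ => Nat.zero_le _)
    (Finset.mem_range.2 (by omega))

theorem half_mul_half_add_half_mul_half (n : ℕ) :
    2 * (n / 2 * (n - n / 2) + (n - 1) / 2 * (n - 1 - (n - 1) / 2)) = n * (n - 1) := by
  obtain ⟨k, rfl | rfl⟩ := Nat.even_or_odd' n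
  · rcases k with _ | k
    · rfl
    · rw [show 2 * (k + 1) / 2 = k + 1 by omega, show 2 * (k + 1) - (k + 1) = k + 1 by omega,
        show 2 * (k + 1) - 1 = 2 * k + 1 by omega, show (2 * k + 1) / 2 = k by omega,
        show 2 * k + 1 - k = k + 1 by omega]
      ring
  · rw [show (2 * k + 1) / 2 = k by omega, show 2 * k + 1 - k = k + 1 by omega,
      show 2 * k + 1 - 1 = 2 * k by omega, show 2 * k / 2 = k by omega,
      show 2 * k - k = k by omega]
    ring

theorem exponent_lt {n d : ℕ} (hn : 2 < n) (hd : 1 ≤ d) (hdn : d ≤ n) :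
    d * (n - d) + (d - 1) + d * d / 4 <
      (n - 1) + n / 2 * (n - n / 2) + (n - 1) / 2 * (n - 1 - (n - 1) / 2) := by
  have h1 := half_mul_half_add_half_mul_half n
  have h2 := Nat.div_mul_le_self (d * d) 4
  generalize d * d / 4 = q at *
  generalize n / 2 * (n - n / 2) = a at *
  generalize (n - 1) / 2 * (n - 1 - (n - 1) / 2) = b at *
  obtain ⟨k, rfl⟩ := Nat.exists_eq_add_of_le hdn
  obtain ⟨c, rfl⟩ := Nat.exists_eq_add_of_le hd
  rw [Nat.add_sub_cancel_left, Nat.add_sub_cancel_left]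
  rw [show 1 + c + k - 1 = c + k by omega] at *
  rcases k with _ | k
  · have : 2 ≤ c := by omega
    nlinarith
  · nlinarith

theorem abs_density_sub_one_le (n p : ℕ) (hn : 2 < n) [Fact p.Prime] :
    |density n p - 1| ≤ 2 * n * (8 ^ n * (n + 1)) / p := by
  set E := (n - 1) + n / 2 * (n - n / 2) + (n - 1) / 2 * (n - 1 - (n - 1) / 2) with hE
  have hp2 : (2 : ℝ) ≤ p := by exact_mod_cast (Fact.out : p.Prime).two_le
  have hp : (0 : ℝ) < p := by linarith
  have hterm : ∀ d ∈ Finset.Icc 1 n, |(gaussBinom p n d : ℝ) * (gaussBinom p d 1 : ℝ) *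
      ((numSubspaces p d : ℝ) - (numSubspaces p (d - 1) : ℝ))| ≤
      8 ^ n * (n + 1) * p ^ (E - 1) := by
    intro d hd
    obtain ⟨hd1, hdn⟩ := Finset.mem_Icc.1 hd
    have h1 : (gaussBinom p n d : ℝ) ≤ 2 ^ n * p ^ (d * (n - d)) := by
      refine le_trans (by exact_mod_cast gaussBinom_le p n d hdn)
        (mul_le_mul_of_nonneg_right (pow_le_pow_right₀ one_le_two hdn) (by positivity))
    have h2 : (gaussBinom p d 1 : ℝ) ≤ 2 ^ n * p ^ (d - 1) := by
      have := gaussBinom_le p d 1 hd1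
      rw [one_mul] at this
      refine le_trans (by exact_mod_cast this)
        (mul_le_mul_of_nonneg_right (pow_le_pow_right₀ one_le_two (by omega)) (by positivity))
    have h3 : ∀ m ≤ d, (numSubspaces p m : ℝ) ≤ (n + 1) * 2 ^ n * p ^ (d * d / 4) := by
      intro m hm
      have hmn : m ≤ n := hm.trans hdn
      have : (numSubspaces p m : ℝ) ≤ (m + 1) * 2 ^ m * p ^ (m * m / 4) := by
        exact_mod_cast numSubspaces_le p m
      refine this.trans ?_
      gcongr
      · norm_num
      · linarith
    have h4 := abs_sub_le_of_nonneg_of_le (Nat.cast_nonneg _) (h3 d le_rfl)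
      (Nat.cast_nonneg _) (h3 (d - 1) (Nat.sub_le _ _))
    rw [abs_mul, abs_of_nonneg (by positivity :
      (0 : ℝ) ≤ (gaussBinom p n d : ℝ) * (gaussBinom p d 1 : ℝ))]
    calc _ ≤ (2 ^ n * (p : ℝ) ^ (d * (n - d))) * (2 ^ n * p ^ (d - 1)) *
          ((n + 1) * 2 ^ n * p ^ (d * d / 4)) := by gcongr
      _ = 8 ^ n * (n + 1) * p ^ (d * (n - d) + (d - 1) + d * d / 4) := by
        rw [pow_add, pow_add, show (8 : ℝ) = 2 * 2 * 2 by norm_num, mul_pow, mul_pow]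
        ring
      _ ≤ _ := by
        have := exponent_lt hn hd1 hdn
        gcongr
        · linarith
        · omega
  have hsum := (Finset.abs_sum_le_sum_abs _ _).trans (Finset.sum_le_sum hterm)
  rw [Finset.sum_const, Nat.card_Icc, Nat.add_sub_cancel, nsmul_eq_mul] at hsum
  have hden : (p : ℝ) ^ E / 2 ≤ (gaussBinom p n 1 : ℝ) * ((numSubspaces p n : ℝ) - 1) *
      (numSubspaces p (n - 1) : ℝ) := by
    have h1 : (p : ℝ) ^ (n - 1) ≤ gaussBinom p n 1 := by
      have := pow_le_gaussBinom p 1 (n - 1)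
      rw [one_mul, Nat.add_sub_cancel' (by omega)] at this
      exact_mod_cast this
    have h2 : (p : ℝ) ^ (n / 2 * (n - n / 2)) / 2 ≤ (numSubspaces p n : ℝ) - 1 := by
      have h : (p : ℝ) ^ (n / 2 * (n - n / 2)) ≤ numSubspaces p n := by
        exact_mod_cast pow_le_numSubspaces p n
      have h' : (p : ℝ) ≤ (p : ℝ) ^ (n / 2 * (n - n / 2)) := by
        refine le_self_pow₀ (by linarith) (Nat.mul_ne_zero ?_ ?_) <;> omega
      linarith
    have h3 : (p : ℝ) ^ ((n - 1) / 2 * (n - 1 - (n - 1) / 2)) ≤ numSubspaces p (n - 1) := by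
      exact_mod_cast pow_le_numSubspaces p (n - 1)
    calc (p : ℝ) ^ E / 2 = p ^ (n - 1) * (p ^ (n / 2 * (n - n / 2)) / 2) *
          p ^ ((n - 1) / 2 * (n - 1 - (n - 1) / 2)) := by
          rw [hE, pow_add, pow_add]; ring
      _ ≤ _ := by
        have h4 := (by positivity : (0 : ℝ) ≤ (p : ℝ) ^ (n / 2 * (n - n / 2)) / 2).trans h2
        gcongr
  have hE1 : (p : ℝ) ^ E = p ^ (E - 1) * p := by
    rw [← pow_succ, Nat.sub_add_cancel (by omega)]
  rw [density, sub_sub_cancel_left, abs_neg, abs_div,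
    abs_of_pos ((by positivity : (0 : ℝ) < (p : ℝ) ^ E / 2).trans_le hden)]
  calc _ ≤ n * (8 ^ n * (n + 1) * (p : ℝ) ^ (E - 1)) / ((p : ℝ) ^ E / 2) := by gcongr
    _ = _ := by rw [hE1]; field_simp

/-- For fixed `n > 2`, `δ(n, p) → 1` as `p → ∞` over primes. -/
theorem density_tendsto_one_in_p (n : ℕ) (hn : 2 < n) :
    ∀ ε : ℝ, 0 < ε → ∃ N : ℕ, ∀ p : ℕ, p.Prime → N ≤ p → |density n p - 1| < ε := by
  intro ε hε
  obtain ⟨N, hN⟩ := exists_nat_gt (2 * n * (8 ^ n * (n + 1)) / ε)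
  refine ⟨N, fun p hp hNp => ?_⟩
  have : Fact p.Prime := ⟨hp⟩
  have hp0 : (0 : ℝ) < p := by exact_mod_cast hp.pos
  refine (abs_density_sub_one_le n p hn).trans_lt ?_
  rw [div_lt_comm₀ hp0 hε]
  exact hN.trans_le (by exact_mod_cast hNp)
end
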